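/- Let 1 ≤ p < ∞. For all f ∈ L^p(𝕋), the nonlinear Fejér means satisfy ‖σ_n^a(f)‖_p ≤ ((1+|a|)/(1-|a|))^{2/p} ‖f‖_p uniformly in n, and ‖f - σ_n^a(f)‖_p → 0 as n → ∞. -/

import Mathlib

open Real MeasureTheory

/-- The Poisson kernel associated with `a = |a| e^{i t_a}`. -/
noncomputable def poisson (a : ℂ) (ta : ℝ) (t : ℝ) : ℝ :=
  (1 - ‖a‖ ^ 2) / (1 - 2 * ‖a‖ * Real.cos (t - ta) + ‖a‖ ^ 2)

/-- The Dirichlet kernel `D_n(u) = sin((n+1/2)u)/sin(u/2)`. -/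
noncomputable def dirichlet (n : ℕ) (u : ℝ) : ℝ :=
  Real.sin (((n : ℝ) + 1 / 2) * u) / Real.sin (u / 2)

/-- The Fejér kernel `K_n = (D_0 + ⋯ + D_n)/(n+1)`. -/
noncomputable def fejer (n : ℕ) (u : ℝ) : ℝ :=
  (1 / ((n : ℝ) + 1)) * ∑ k ∈ Finset.range (n + 1), dirichlet k u

/-- The `k`-th nonlinear Fourier coefficient of `f`. -/
noncomputable def coeff (θ p : ℝ → ℝ) (f : ℝ → ℂ) (k : ℤ) : ℂ :=
  (1 / (2 * π)) * ∫ t in (-π)..π,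
    f t * Complex.exp (-(Complex.I * (k : ℂ) * (θ t : ℂ))) * (p t : ℂ)

/-- The `n`-th partial sum of the nonlinear Fourier series of `f`. -/
noncomputable def partialSum (θ p : ℝ → ℝ) (f : ℝ → ℂ) (n : ℕ) (x : ℝ) : ℂ :=
  ∑ k ∈ Finset.Icc (-(n : ℤ)) (n : ℤ),
    coeff θ p f k * Complex.exp (Complex.I * (k : ℂ) * (θ x : ℂ))

/-- The `n`-th Fejér (Cesàro) mean of the nonlinear Fourier series of `f`. -/
noncomputable def cesaro (θ p : ℝ → ℝ) (f : ℝ → ℂ) (n : ℕ) (x : ℝ) : ℂ :=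
  (1 / ((n : ℂ) + 1)) * ∑ k ∈ Finset.range (n + 1), partialSum θ p f k x

/-- The normalized `L^p` norm on one period. -/
noncomputable def pNorm (p : ℝ) (g : ℝ → ℂ) : ℝ :=
  ((1 / (2 * π)) * ∫ t in (-π)..π, ‖g t‖ ^ p) ^ (1 / p)


theorem cm_dir (z : ℂ) (hz : z ≠ 0) (n : ℕ) :
    ∑ k ∈ Finset.Icc (-(n : ℤ)) (n : ℤ), z ^ k
      = 1 + ∑ j ∈ Finset.range n, (z ^ (j + 1) + (z⁻¹) ^ (j + 1)) := by
  induction n with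
  | zero => simp
  | succ n ih =>
    have h : Finset.Icc (-((n + 1 : ℕ) : ℤ)) ((n + 1 : ℕ) : ℤ)
        = insert (-((n + 1 : ℕ) : ℤ)) (insert ((n + 1 : ℕ) : ℤ) (Finset.Icc (-(n : ℤ)) (n : ℤ))) := by
      ext x; simp; omega
    rw [h, Finset.sum_insert (by simp; omega), Finset.sum_insert (by simp), ih,
      Finset.sum_range_succ]
    rw [zpow_neg, zpow_natCast, inv_pow]
    ring

theorem cm_fej (z : ℂ) (hz : z ≠ 0) (n : ℕ) :
    ∑ m ∈ Finset.range (n + 1), ∑ k ∈ Finset.Icc (-(m : ℤ)) (m : ℤ), z ^ k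
      = (∑ j ∈ Finset.range (n + 1), z ^ j) * (∑ j ∈ Finset.range (n + 1), (z⁻¹) ^ j) := by
  have key : ∀ n : ℕ, (∑ j ∈ Finset.range (n + 1), z ^ j) * (z⁻¹) ^ (n + 1) =
      ∑ j ∈ Finset.range (n + 1), (z⁻¹) ^ (j + 1) := by
    intro n
    rw [← Finset.sum_range_reflect, Finset.sum_mul]
    refine Finset.sum_congr rfl fun j hj => ?_
    have hj' := Finset.mem_range.1 hj
    have : n + 1 = (n + 1 - 1 - j) + (j + 1) := by omega
    conv_lhs => rw [this]
    rw [pow_add]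
    simp only [add_tsub_cancel_right, inv_pow]
    have e : n - j + (j + 1) - 1 - j = n - j := by omega
    rw [e]
    field_simp
  have key2 : ∀ n : ℕ, (∑ j ∈ Finset.range (n + 1), (z⁻¹) ^ j) * z ^ (n + 1) =
      ∑ j ∈ Finset.range (n + 1), z ^ (j + 1) := by
    intro n
    rw [← Finset.sum_range_reflect, Finset.sum_mul]
    refine Finset.sum_congr rfl fun j hj => ?_
    have hj' := Finset.mem_range.1 hj
    have : n + 1 = (n + 1 - 1 - j) + (j + 1) := by omega
    conv_lhs => rw [this]
    rw [pow_add]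
    simp only [add_tsub_cancel_right, inv_pow]
    have e : n - j + (j + 1) - 1 - j = n - j := by omega
    rw [e]
    field_simp
  induction n with
  | zero => simp
  | succ n ih =>
    rw [Finset.sum_range_succ, ih, cm_dir z hz, Finset.sum_add_distrib, ← key, ← key2,
      Finset.sum_range_succ _ (n + 1), Finset.sum_range_succ _ (n + 1)]
    have : z ^ (n+1) * z⁻¹ ^ (n+1) = 1 := by
      rw [← mul_pow, mul_inv_cancel₀ hz, one_pow]
    linear_combination (-1 : ℂ) * this

/-- The Fejér kernel as a square. -/
noncomputable def cmK (n : ℕ) (u : ℝ) : ℝ :=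
  ‖∑ j ∈ Finset.range (n + 1), Complex.exp (Complex.I * u) ^ j‖ ^ 2 / ((n : ℝ) + 1)

theorem cmK_eq (n : ℕ) (u : ℝ) : (cmK n u : ℂ) = (1 / ((n : ℂ) + 1)) *
    ∑ m ∈ Finset.range (n + 1), ∑ k ∈ Finset.Icc (-(m : ℤ)) (m : ℤ),
      Complex.exp (Complex.I * u) ^ k := by
  rw [cm_fej _ (Complex.exp_ne_zero _), cmK]
  push_cast
  rw [← Complex.mul_conj', map_sum]
  have : (starRingEnd ℂ) (Complex.exp (Complex.I * u)) = (Complex.exp (Complex.I * u))⁻¹ := by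
    rw [← Complex.exp_conj, ← Complex.exp_neg]; simp
  simp only [map_pow, this]
  ring

theorem cmK_nonneg (n : ℕ) (u : ℝ) : 0 ≤ cmK n u := by unfold cmK; positivity

theorem cmK_neg (n : ℕ) (u : ℝ) : cmK n (-u) = cmK n u := by
  unfold cmK
  congr 2
  rw [← Complex.norm_conj, map_sum]
  congr 1
  refine Finset.sum_congr rfl fun j _ => ?_
  rw [map_pow, ← Complex.exp_conj]; simp

theorem cmK_cont (n : ℕ) : Continuous (cmK n) := by unfold cmK; fun_prop

theorem cmK_le (n : ℕ) (u : ℝ) : cmK n u ≤ (n : ℝ) + 1 := by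
  unfold cmK
  rw [div_le_iff₀ (by positivity), ← sq]
  gcongr
  refine (norm_sum_le _ _).trans ?_
  have : ‖Complex.exp (Complex.I * u)‖ = 1 := by
    rw [mul_comm]; exact Complex.norm_exp_ofReal_mul_I u
  simp [norm_pow, this]

theorem cmK_le' (n : ℕ) (u : ℝ) :
    cmK n u * ‖Complex.exp (Complex.I * u) - 1‖ ^ 2 ≤ 4 / ((n : ℝ) + 1) := by
  unfold cmK
  rw [div_mul_eq_mul_div]
  gcongr
  rw [← mul_pow, ← norm_mul, geom_sum_mul]
  have h1 : ‖Complex.exp (Complex.I * u)‖ = 1 := by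
    rw [mul_comm]; exact Complex.norm_exp_ofReal_mul_I u
  have : ‖Complex.exp (Complex.I * u) ^ (n + 1) - 1‖ ≤ 2 := by
    refine (norm_sub_le _ _).trans ?_
    rw [norm_pow, h1]; norm_num
  nlinarith [norm_nonneg (Complex.exp (Complex.I * u) ^ (n + 1) - 1)]

open scoped ENNReal in
theorem cm_schur (μ : Measure ℝ) [SFinite μ] (k : ℝ → ℝ → ℝ)
    (hk : Continuous (Function.uncurry k)) (hk0 : ∀ x t, 0 ≤ k x t)
    (h1 : ∀ x, ∫⁻ t, ENNReal.ofReal (k x t) ∂μ = 1)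
    (h2 : ∀ t, ∫⁻ x, ENNReal.ofReal (k x t) ∂μ = 1)
    (p : ℝ) (hp : 1 ≤ p) (f : ℝ → ℂ) (hf : Measurable f) :
    eLpNorm (fun x => ∫ t, f t * (k x t : ℂ) ∂μ) (ENNReal.ofReal p) μ
      ≤ eLpNorm f (ENNReal.ofReal p) μ := by
  have hp0 : 0 < p := by linarith
  have hpe : ENNReal.ofReal p ≠ 0 := by simpa using hp0
  have hpt : ENNReal.ofReal p ≠ ∞ := ENNReal.ofReal_ne_top
  rw [eLpNorm_eq_lintegral_rpow_enorm_toReal hpe hpt, eLpNorm_eq_lintegral_rpow_enorm_toReal hpe hpt,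
    ENNReal.toReal_ofReal hp0.le]
  refine ENNReal.rpow_le_rpow ?_ (by positivity)
  have hkx : ∀ x, Measurable (fun t => ENNReal.ofReal (k x t)) := fun x =>
    ENNReal.measurable_ofReal.comp (hk.comp (Continuous.prodMk_right x)).measurable
  have hkm : Measurable (fun q : ℝ × ℝ => ENNReal.ofReal (k q.1 q.2)) :=
    ENNReal.measurable_ofReal.comp hk.measurable
  have hfe : Measurable (fun t => ‖f t‖ₑ ^ p) := hf.enorm.pow_const p
  have step : ∀ x, ‖∫ t, f t * (k x t : ℂ) ∂μ‖ₑ ^ p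
      ≤ ∫⁻ t, ENNReal.ofReal (k x t) * ‖f t‖ₑ ^ p ∂μ := by
    intro x
    have e1 : ‖∫ t, f t * (k x t : ℂ) ∂μ‖ₑ ≤ ∫⁻ t, ENNReal.ofReal (k x t) * ‖f t‖ₑ ∂μ := by
      refine (enorm_integral_le_lintegral_enorm _).trans (le_of_eq ?_)
      refine lintegral_congr fun t => ?_
      rw [enorm_mul, mul_comm]
      congr 1
      rw [← ofReal_norm, Complex.norm_real, Real.norm_of_nonneg (hk0 x t)]
    set ν := μ.withDensity (fun t => ENNReal.ofReal (k x t)) with hν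
    have : IsProbabilityMeasure ν := ⟨by rw [hν, withDensity_apply _ MeasurableSet.univ]; simpa using h1 x⟩
    have e2 : ∫⁻ t, ENNReal.ofReal (k x t) * ‖f t‖ₑ ∂μ = ∫⁻ t, ‖f t‖ₑ ∂ν := by
      rw [hν, lintegral_withDensity_eq_lintegral_mul _ (hkx x) hf.enorm]; rfl
    have e3 : ∫⁻ t, ENNReal.ofReal (k x t) * ‖f t‖ₑ ^ p ∂μ = ∫⁻ t, ‖f t‖ₑ ^ p ∂ν := by
      rw [hν, lintegral_withDensity_eq_lintegral_mul _ (hkx x) hfe]; rfl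
    rw [e3]
    rw [e2] at e1
    have e4 := eLpNorm_le_eLpNorm_of_exponent_le (μ := ν) (f := f) (p := 1) (q := ENNReal.ofReal p)
      (by simpa using hp) hf.aestronglyMeasurable
    rw [eLpNorm_one_eq_lintegral_enorm, eLpNorm_eq_lintegral_rpow_enorm_toReal hpe hpt,
      ENNReal.toReal_ofReal hp0.le] at e4
    have e5 := ENNReal.rpow_le_rpow (e1.trans e4) hp0.le
    rwa [← ENNReal.rpow_mul, one_div_mul_cancel hp0.ne', ENNReal.rpow_one] at e5
  refine (lintegral_mono step).trans ?_
  rw [lintegral_lintegral_swap]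
  · refine le_of_eq (lintegral_congr fun t => ?_)
    rw [lintegral_mul_const, h2, one_mul]
    exact ENNReal.measurable_ofReal.comp (hk.comp (Continuous.prodMk_left t)).measurable
  · exact (hkm.mul (hfe.comp measurable_snd)).aemeasurable

theorem cm_den_pos (r c : ℝ) (h0 : 0 ≤ r) (h1 : r < 1) (hc : c ≤ 1) :
    (1 - r) ^ 2 ≤ 1 - 2 * r * c + r ^ 2 := by nlinarith

theorem cm_poisson_cont (a : ℂ) (ha : ‖a‖ < 1) (ta : ℝ) : Continuous (poisson a ta) := by
  unfold poisson
  refine Continuous.div (by fun_prop) (by fun_prop) fun t => ?_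
  have := cm_den_pos ‖a‖ (Real.cos (t - ta)) (norm_nonneg _) ha (Real.cos_le_one _)
  have h2 : 0 < (1 - ‖a‖) ^ 2 := by have : 0 < 1 - ‖a‖ := by linarith
                                    positivity
  linarith

theorem cm_poisson_le (a : ℂ) (ha : ‖a‖ < 1) (ta t : ℝ) :
    poisson a ta t ≤ (1 + ‖a‖) / (1 - ‖a‖) := by
  unfold poisson
  have h := cm_den_pos ‖a‖ (Real.cos (t - ta)) (norm_nonneg _) ha (Real.cos_le_one _)
  have h1 : 0 < 1 - ‖a‖ := by linarith
  have h2 : 0 < (1 - ‖a‖) ^ 2 := by positivity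
  rw [div_le_div_iff₀ (by linarith) h1]
  have := mul_le_mul_of_nonneg_left h (show 0 ≤ 1 + ‖a‖ by positivity)
  nlinarith

theorem cm_poisson_ge (a : ℂ) (ha : ‖a‖ < 1) (ta t : ℝ) :
    1 ≤ (1 + ‖a‖) / (1 - ‖a‖) * poisson a ta t := by
  unfold poisson
  have h := cm_den_pos ‖a‖ (Real.cos (t - ta)) (norm_nonneg _) ha (Real.cos_le_one _)
  have h1 : 0 < 1 - ‖a‖ := by linarith
  have h2 : 0 < (1 - ‖a‖) ^ 2 := by positivity
  rw [div_mul_div_comm, le_div_iff₀ (by apply mul_pos h1; linarith)]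
  have h3 := Real.neg_one_le_cos (t - ta)
  have h4 : 1 - 2 * ‖a‖ * Real.cos (t - ta) + ‖a‖ ^ 2 ≤ (1 + ‖a‖) ^ 2 := by
    nlinarith [norm_nonneg a]
  have := mul_le_mul_of_nonneg_left h4 h1.le
  nlinarith

theorem cm_poisson_pos (a : ℂ) (ha : ‖a‖ < 1) (ta t : ℝ) : 0 < poisson a ta t := by
  have h := cm_poisson_ge a ha ta t
  have h1 : 0 < 1 - ‖a‖ := by linarith
  have : 0 < (1 + ‖a‖) / (1 - ‖a‖) := by positivity
  by_contra hc
  push Not at hc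
  nlinarith

/-- The weighted measure. -/
noncomputable def cmMu (w : ℝ → ℝ) : Measure ℝ :=
  (volume.restrict (Set.Ioc (-π) π)).withDensity (fun t => ENNReal.ofReal (w t / (2 * π)))

theorem cmMu_integral (w : ℝ → ℝ) (hw : Continuous w) (hw0 : ∀ t, 0 < w t) (g : ℝ → ℂ) :
    ∫ t, g t ∂(cmMu w) = (1 / (2 * π)) * ∫ t in (-π)..π, g t * (w t : ℂ) := by
  rw [cmMu, integral_withDensity_eq_integral_toReal_smul (by fun_prop) (by simp),
    intervalIntegral.integral_of_le (by linarith [pi_pos]), ← integral_const_mul]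
  refine integral_congr_ae (Filter.Eventually.of_forall fun t => ?_)
  have := hw0 t
  simp only
  rw [ENNReal.toReal_ofReal (by positivity), Complex.real_smul]
  push_cast
  ring

theorem cmMu_le (w : ℝ → ℝ) (M : ℝ) (hwM : ∀ t, w t ≤ M) :
    cmMu w ≤ ENNReal.ofReal (M / (2 * π)) • volume.restrict (Set.Ioc (-π) π) := by
  rw [cmMu, ← withDensity_const]
  refine withDensity_mono (Filter.Eventually.of_forall fun t => ?_)
  apply ENNReal.ofReal_le_ofReal
  gcongr
  exact hwM t

theorem cmMu_ge (w : ℝ → ℝ) (hw : Continuous w) (M : ℝ) (hM : 0 < M) (hwM : ∀ t, 1 ≤ M * w t) :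
    volume.restrict (Set.Ioc (-π) π) ≤ ENNReal.ofReal (M * (2 * π)) • cmMu w := by
  rw [cmMu, ← withDensity_smul _ (by fun_prop)]
  conv_lhs => rw [← withDensity_one (μ := volume.restrict (Set.Ioc (-π) π))]
  refine withDensity_mono (Filter.Eventually.of_forall fun t => ?_)
  simp only [Pi.one_apply, Pi.smul_apply, smul_eq_mul]
  rw [← ENNReal.ofReal_mul (by positivity), ENNReal.one_le_ofReal]
  have := hwM t
  field_simp
  linarith

theorem cmMu_finite (w : ℝ → ℝ) (M : ℝ) (hwM : ∀ t, w t ≤ M) : IsFiniteMeasure (cmMu w) := by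
  refine ⟨(cmMu_le w M hwM Set.univ).trans_lt ?_⟩
  simp only [Measure.smul_apply, smul_eq_mul]
  exact ENNReal.mul_lt_top ENNReal.ofReal_lt_top (measure_lt_top _ _)

theorem cm_cesaro_eq (θ w : ℝ → ℝ) (hθ : Continuous θ) (hw : Continuous w) (hw0 : ∀ t, 0 < w t)
    (f : ℝ → ℂ) (hf : Integrable f (cmMu w)) (n : ℕ) (x : ℝ) :
    cesaro θ w f n x = ∫ t, f t * (cmK n (θ x - θ t) : ℂ) ∂(cmMu w) := by
  have hc : ∀ k : ℤ, coeff θ w f k * Complex.exp (Complex.I * (k : ℂ) * (θ x : ℂ))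
      = ∫ t, f t * Complex.exp (Complex.I * ((θ x - θ t : ℝ) : ℂ)) ^ k ∂(cmMu w) := by
    intro k
    rw [coeff, ← cmMu_integral w hw hw0 (fun t => f t * Complex.exp (-(Complex.I * (k : ℂ) * (θ t : ℂ)))),
      ← integral_mul_const]
    refine integral_congr_ae (Filter.Eventually.of_forall fun t => ?_)
    simp only
    rw [mul_assoc, ← Complex.exp_add, ← Complex.exp_int_mul]
    congr 2
    push_cast
    ring
  have hi : ∀ k : ℤ, Integrable
      (fun t => f t * Complex.exp (Complex.I * ((θ x - θ t : ℝ) : ℂ)) ^ k) (cmMu w) := by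
    intro k
    refine hf.mul_bdd (c := 1) ?_ ?_
    · simp only [← Complex.exp_int_mul]
      exact Continuous.aestronglyMeasurable (by fun_prop)
    · refine Filter.Eventually.of_forall fun t => ?_
      rw [norm_zpow, mul_comm, Complex.norm_exp_ofReal_mul_I, one_zpow]
  simp only [cesaro, partialSum, hc]
  simp only [cmK_eq]
  have : ∀ m : ℕ, ∑ k ∈ Finset.Icc (-(m : ℤ)) (m : ℤ),
      ∫ t, f t * Complex.exp (Complex.I * ((θ x - θ t : ℝ) : ℂ)) ^ k ∂(cmMu w) =
      ∫ t, ∑ k ∈ Finset.Icc (-(m : ℤ)) (m : ℤ),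
        f t * Complex.exp (Complex.I * ((θ x - θ t : ℝ) : ℂ)) ^ k ∂(cmMu w) := fun m =>
    (integral_finsetSum _ fun k _ => hi k).symm
  simp only [this]
  rw [← integral_finsetSum _ fun m _ => integrable_finsetSum _ fun k _ => hi k,
    ← integral_const_mul]
  refine integral_congr_ae (Filter.Eventually.of_forall fun t => ?_)
  simp only [Finset.mul_sum]
  refine Finset.sum_congr rfl fun m _ => Finset.sum_congr rfl fun k _ => ?_
  ring

theorem cm_coeff_one (θ w : ℝ → ℝ) (hθ : Continuous θ) (hw : Continuous w)
    (hper : ∀ t : ℝ, θ (t + 2 * π) = θ t + 2 * π) (hd : ∀ t, HasDerivAt θ (w t) t) (k : ℤ) :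
    coeff θ w (fun _ => 1) k = if k = 0 then 1 else 0 := by
  have h2 : θ π = θ (-π) + 2 * π := by rw [← hper]; congr 1; ring
  have hpi : (π : ℂ) ≠ 0 := by exact_mod_cast pi_ne_zero
  unfold coeff
  split_ifs with hk
  · subst hk
    have : ∫ t in (-π)..π, ((w t : ℝ) : ℂ) = ((θ π - θ (-π) : ℝ) : ℂ) := by
      rw [intervalIntegral.integral_ofReal]
      congr 1
      exact intervalIntegral.integral_eq_sub_of_hasDerivAt (fun t _ => hd t)
        (hw.intervalIntegrable _ _)
    simp only [Int.cast_zero, mul_zero, zero_mul, neg_zero, Complex.exp_zero, one_mul]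
    rw [this, h2]
    push_cast
    field_simp
    ring
  · have hkc : (k : ℂ) ≠ 0 := by exact_mod_cast hk
    have hder : ∀ t, HasDerivAt (fun t : ℝ => Complex.exp (-(Complex.I * (k : ℂ) * (θ t : ℂ)))
        / (-(Complex.I * k)))
        (1 * Complex.exp (-(Complex.I * (k : ℂ) * (θ t : ℂ))) * (w t : ℂ)) t := by
      intro t
      have h := ((((hd t).ofReal_comp).const_mul (Complex.I * (k : ℂ))).neg.cexp).div_const
        (-(Complex.I * (k : ℂ)))
      refine h.congr_deriv ?_
      have hne : -(Complex.I * (k : ℂ)) ≠ 0 := neg_ne_zero.2 (mul_ne_zero Complex.I_ne_zero hkc)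
      rw [div_eq_iff hne, Pi.neg_apply]
      ring
    rw [intervalIntegral.integral_eq_sub_of_hasDerivAt (fun t _ => hder t)
      (Continuous.intervalIntegrable (by fun_prop) _ _), h2]
    have : Complex.exp (-(Complex.I * (k : ℂ) * ((θ (-π) + 2 * π : ℝ) : ℂ)))
        = Complex.exp (-(Complex.I * (k : ℂ) * ((θ (-π) : ℝ) : ℂ))) := by
      rw [Complex.exp_eq_exp_iff_exists_int]
      refine ⟨-k, ?_⟩
      push_cast
      ring
    rw [this]
    simp

theorem cm_cesaro_one (θ w : ℝ → ℝ) (hθ : Continuous θ) (hw : Continuous w)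
    (hper : ∀ t : ℝ, θ (t + 2 * π) = θ t + 2 * π) (hd : ∀ t, HasDerivAt θ (w t) t) (n : ℕ) (x : ℝ) :
    cesaro θ w (fun _ => 1) n x = 1 := by
  simp only [cesaro, partialSum, cm_coeff_one θ w hθ hw hper hd]
  have : (n : ℂ) + 1 ≠ 0 := by exact_mod_cast n.succ_ne_zero
  simp [this]

theorem cm_int_one (θ w : ℝ → ℝ) (hθ : Continuous θ) (hw : Continuous w) (hw0 : ∀ t, 0 < w t)
    (M : ℝ) (hwM : ∀ t, w t ≤ M)
    (hper : ∀ t : ℝ, θ (t + 2 * π) = θ t + 2 * π) (hd : ∀ t, HasDerivAt θ (w t) t) (n : ℕ) (x : ℝ) :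
    ∫ t, cmK n (θ x - θ t) ∂(cmMu w) = 1 := by
  have := cmMu_finite w M hwM
  have h := cm_cesaro_eq θ w hθ hw hw0 (fun _ => 1) (integrable_const _) n x
  rw [cm_cesaro_one θ w hθ hw hper hd] at h
  simp only [one_mul] at h
  rw [integral_complex_ofReal] at h
  exact_mod_cast h.symm

theorem cm_lint_one (θ w : ℝ → ℝ) (hθ : Continuous θ) (hw : Continuous w) (hw0 : ∀ t, 0 < w t)
    (M : ℝ) (hwM : ∀ t, w t ≤ M)
    (hper : ∀ t : ℝ, θ (t + 2 * π) = θ t + 2 * π) (hd : ∀ t, HasDerivAt θ (w t) t) (n : ℕ) (x : ℝ) :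
    ∫⁻ t, ENNReal.ofReal (cmK n (θ x - θ t)) ∂(cmMu w) = 1 := by
  have := cmMu_finite w M hwM
  rw [← ofReal_integral_eq_lintegral_ofReal, cm_int_one θ w hθ hw hw0 M hwM hper hd]
  · simp
  · refine (integrable_const ((n : ℝ) + 1)).mono'
      ((cmK_cont n).comp (by fun_prop)).aestronglyMeasurable
      (Filter.Eventually.of_forall fun t => ?_)
    rw [Real.norm_of_nonneg (cmK_nonneg _ _)]
    exact cmK_le _ _
  · exact Filter.Eventually.of_forall fun t => cmK_nonneg _ _

theorem cmMu_restrict (w : ℝ → ℝ) : (cmMu w).restrict (Set.Icc (-π) π) = cmMu w := by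
  rw [cmMu, restrict_withDensity measurableSet_Icc, Measure.restrict_restrict measurableSet_Icc,
    Set.inter_eq_self_of_subset_right Set.Ioc_subset_Icc_self]

theorem cm_peak (θ w : ℝ → ℝ) (hθ : Continuous θ) (hm : StrictMono θ) (hw : Continuous w)
    (hw0 : ∀ t, 0 < w t) (M : ℝ) (hwM : ∀ t, w t ≤ M)
    (hper : ∀ t : ℝ, θ (t + 2 * π) = θ t + 2 * π) (hd : ∀ t, HasDerivAt θ (w t) t)
    (g : ℝ → ℂ) (hg : Continuous g) (hgi : Integrable g (cmMu w)) (x : ℝ)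
    (hx : x ∈ Set.Ioo (-π) π) :
    Filter.Tendsto (fun n : ℕ => cesaro θ w g n x) Filter.atTop (nhds (g x)) := by
  have := cmMu_finite w M hwM
  have hxs : Set.Icc (-π) π ∈ nhds x := Icc_mem_nhds hx.1 hx.2
  have key := tendsto_setIntegral_peak_smul_of_integrableOn_of_tendsto (μ := cmMu w)
    (s := Set.Icc (-π) π) (t := Set.Icc (-π) π) (x₀ := x) (l := Filter.atTop)
    (φ := fun (n : ℕ) t => cmK n (θ x - θ t)) (g := g) (a := g x)
    measurableSet_Icc measurableSet_Icc subset_rfl self_mem_nhdsWithin (measure_ne_top _ _)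
    (Filter.Eventually.of_forall fun n t _ => cmK_nonneg _ _) ?_ ?_ ?_ ?_ ?_
  · rw [cmMu_restrict] at key
    refine key.congr fun n => ?_
    rw [cm_cesaro_eq θ w hθ hw hw0 g hgi]
    refine integral_congr_ae (Filter.Eventually.of_forall fun t => ?_)
    simp only [Complex.real_smul]
    ring
  · intro u hu hxu
    have hcomp : IsCompact (Set.Icc (-π) π \ u) := isCompact_Icc.diff hu
    have hpos : ∃ c > 0, ∀ t ∈ Set.Icc (-π) π \ u,
        c ≤ ‖Complex.exp (Complex.I * ((θ x - θ t : ℝ) : ℂ)) - 1‖ ^ 2 := by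
      rcases (Set.Icc (-π) π \ u).eq_empty_or_nonempty with he | hne
      · exact ⟨1, one_pos, by simp [he]⟩
      · obtain ⟨t0, ht0, hmin⟩ := hcomp.exists_isMinOn hne
          (f := fun t => ‖Complex.exp (Complex.I * ((θ x - θ t : ℝ) : ℂ)) - 1‖ ^ 2)
          (Continuous.continuousOn (by fun_prop))
        refine ⟨_, ?_, fun t ht => hmin ht⟩
        have hne0 : Complex.exp (Complex.I * ((θ x - θ t0 : ℝ) : ℂ)) - 1 ≠ 0 := by
          intro h0
          rw [sub_eq_zero, Complex.exp_eq_one_iff] at h0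
          obtain ⟨j, hj⟩ := h0
          have hj' : θ x - θ t0 = j * (2 * π) := by
            have : Complex.I * ((θ x - θ t0 : ℝ) : ℂ) = Complex.I * ((j * (2 * π) : ℝ) : ℂ) := by
              rw [hj]; push_cast; ring
            exact_mod_cast mul_left_cancel₀ Complex.I_ne_zero this
          have h2 : θ π = θ (-π) + 2 * π := by rw [← hper]; congr 1; ring
          have a1 := hm hx.1
          have a2 := hm hx.2
          have a3 := hm.monotone ht0.1.1
          have a4 := hm.monotone ht0.1.2
          have b1 : (j : ℝ) < 1 := by
            by_contra hc; push Not at hc; nlinarith [pi_pos]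
          have b2 : (-1 : ℝ) < j := by
            by_contra hc; push Not at hc; nlinarith [pi_pos]
          have b1' : j < 1 := by exact_mod_cast b1
          have b2' : -1 < j := by exact_mod_cast b2
          have : j = 0 := by omega
          subst this
          have : θ x = θ t0 := by simpa [sub_eq_zero] using hj'
          exact ht0.2 (hm.injective this ▸ hxu)
        have := norm_pos_iff.2 hne0
        positivity
    obtain ⟨c, hc, hcb⟩ := hpos
    rw [Metric.tendstoUniformlyOn_iff]
    intro ε hε
    have hlim : Filter.Tendsto (fun n : ℕ => 4 / c * (1 / ((n : ℝ) + 1))) Filter.atTop (nhds 0) := by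
      simpa using (tendsto_one_div_add_atTop_nhds_zero_nat (𝕜 := ℝ)).const_mul (4 / c)
    filter_upwards [hlim.eventually_lt_const hε] with n hn t ht
    simp only [Pi.zero_apply, dist_zero_left]
    rw [Real.norm_of_nonneg (cmK_nonneg _ _)]
    refine lt_of_le_of_lt ?_ hn
    have h1 := cmK_le' n (θ x - θ t)
    have h2 := mul_le_mul_of_nonneg_left (hcb t ht) (cmK_nonneg n (θ x - θ t))
    have h3 : cmK n (θ x - θ t) * c ≤ 4 / ((n : ℝ) + 1) := h2.trans h1
    rw [← le_div_iff₀ hc] at h3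
    refine h3.trans (le_of_eq ?_)
    ring
  · rw [cmMu_restrict]
    simp only [cm_int_one θ w hθ hw hw0 M hwM hper hd]
    exact tendsto_const_nhds
  · exact Filter.Eventually.of_forall fun n =>
      ((cmK_cont n).comp (by fun_prop)).aestronglyMeasurable
  · exact hgi.integrableOn
  · exact (hg.tendsto x).mono_left nhdsWithin_le_nhds

theorem cm_cesaro_cont (θ w : ℝ → ℝ) (hθ : Continuous θ) (f : ℝ → ℂ) (n : ℕ) :
    Continuous (cesaro θ w f n) := by
  unfold cesaro partialSum
  fun_prop

theorem cm_contract (θ w : ℝ → ℝ) (hθ : Continuous θ) (hw : Continuous w)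
    (hw0 : ∀ t, 0 < w t) (M : ℝ) (hwM : ∀ t, w t ≤ M)
    (hper : ∀ t : ℝ, θ (t + 2 * π) = θ t + 2 * π) (hd : ∀ t, HasDerivAt θ (w t) t)
    (f : ℝ → ℂ) (hf : Measurable f) (hfi : Integrable f (cmMu w)) (p : ℝ) (hp : 1 ≤ p) (n : ℕ) :
    eLpNorm (cesaro θ w f n) (ENNReal.ofReal p) (cmMu w) ≤ eLpNorm f (ENNReal.ofReal p) (cmMu w) := by
  have := cmMu_finite w M hwM
  have h := cm_schur (cmMu w) (fun x t => cmK n (θ x - θ t)) ((cmK_cont n).comp (by fun_prop))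
    (fun x t => cmK_nonneg _ _) (cm_lint_one θ w hθ hw hw0 M hwM hper hd n) (fun t => by
      rw [← cm_lint_one θ w hθ hw hw0 M hwM hper hd n t]
      refine lintegral_congr fun x => ?_
      rw [← cmK_neg, neg_sub]) p hp f hf
  convert h using 2
  funext x
  exact cm_cesaro_eq θ w hθ hw hw0 f hfi n x

open scoped ENNReal in
theorem cm_conv_cont (θ w : ℝ → ℝ) (hθ : Continuous θ) (hm : StrictMono θ) (hw : Continuous w)
    (hw0 : ∀ t, 0 < w t) (M : ℝ) (hwM : ∀ t, w t ≤ M)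
    (hper : ∀ t : ℝ, θ (t + 2 * π) = θ t + 2 * π) (hd : ∀ t, HasDerivAt θ (w t) t)
    (g : ℝ → ℂ) (hg : Continuous g) (C : ℝ) (hC : ∀ t, ‖g t‖ ≤ C) (p : ℝ) (hp : 1 ≤ p) :
    Filter.Tendsto (fun n : ℕ => eLpNorm (g - cesaro θ w g n) (ENNReal.ofReal p) (cmMu w))
      Filter.atTop (nhds 0) := by
  have := cmMu_finite w M hwM
  have hgi : Integrable g (cmMu w) := (integrable_const C).mono' hg.aestronglyMeasurable
    (Filter.Eventually.of_forall hC)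
  have hp0 : 0 < p := by linarith
  have hpe : ENNReal.ofReal p ≠ 0 := by simpa using hp0
  have hpt : ENNReal.ofReal p ≠ ∞ := ENNReal.ofReal_ne_top
  have hbd : ∀ n x, ‖cesaro θ w g n x‖ ≤ C := by
    intro n x
    rw [cm_cesaro_eq θ w hθ hw hw0 g hgi]
    have hKi : Integrable (fun t => cmK n (θ x - θ t)) (cmMu w) := by
      by_contra hc
      have := cm_int_one θ w hθ hw hw0 M hwM hper hd n x
      rw [integral_undef hc] at this
      exact zero_ne_one this
    calc _ ≤ ∫ t, C * cmK n (θ x - θ t) ∂(cmMu w) := by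
          refine norm_integral_le_of_norm_le (hKi.const_mul C)
            (Filter.Eventually.of_forall fun t => ?_)
          rw [norm_mul, Complex.norm_real, Real.norm_of_nonneg (cmK_nonneg _ _)]
          exact mul_le_mul_of_nonneg_right (hC t) (cmK_nonneg _ _)
      _ = C := by
          rw [integral_const_mul, cm_int_one θ w hθ hw hw0 M hwM hper hd, mul_one]
  have hae : ∀ᵐ x ∂(cmMu w), x ∈ Set.Ioo (-π) π := by
    refine (withDensity_absolutelyContinuous _ _).ae_le ?_
    rw [← Measure.restrict_congr_set Ioo_ae_eq_Ioc]
    exact ae_restrict_mem measurableSet_Ioo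
  have hlim : Filter.Tendsto (fun n : ℕ => ∫⁻ x, ‖(g - cesaro θ w g n) x‖ₑ ^ p ∂(cmMu w))
      Filter.atTop (nhds (∫⁻ x, 0 ∂(cmMu w))) := by
    refine tendsto_lintegral_of_dominated_convergence (fun _ => (ENNReal.ofReal (C + C)) ^ p)
      ?_ ?_ ?_ ?_
    · intro n
      exact ((hg.sub (cm_cesaro_cont θ w hθ g n)).measurable.enorm).pow_const p
    · intro n
      refine Filter.Eventually.of_forall fun x => ?_
      refine ENNReal.rpow_le_rpow ?_ hp0.le
      rw [← ofReal_norm]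
      exact ENNReal.ofReal_le_ofReal ((norm_sub_le _ _).trans (add_le_add (hC x) (hbd n x)))
    · rw [lintegral_const]
      exact ENNReal.mul_ne_top (ENNReal.rpow_ne_top_of_nonneg hp0.le ENNReal.ofReal_ne_top)
        (measure_ne_top _ _)
    · filter_upwards [hae] with x hx
      have h := cm_peak θ w hθ hm hw hw0 M hwM hper hd g hg hgi x hx
      have h2 := (ENNReal.continuous_rpow_const (y := p)).tendsto _ |>.comp
        ((tendsto_const_nhds (x := g x)).sub h).enorm
      simpa [hp0, Function.comp_def] using h2
  rw [lintegral_zero] at hlim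
  have h2 := (ENNReal.continuous_rpow_const (y := 1 / p)).tendsto _ |>.comp hlim
  rw [ENNReal.zero_rpow_of_pos (by positivity)] at h2
  refine h2.congr fun n => ?_
  rw [eLpNorm_eq_lintegral_rpow_enorm_toReal hpe hpt, ENNReal.toReal_ofReal hp0.le]
  rfl

theorem cm_cesaro_sub (θ w : ℝ → ℝ) (hθ : Continuous θ) (hw : Continuous w)
    (hw0 : ∀ t, 0 < w t) (f g : ℝ → ℂ) (hf : Integrable f (cmMu w)) (hg : Integrable g (cmMu w))
    (n : ℕ) : cesaro θ w (f - g) n = cesaro θ w f n - cesaro θ w g n := by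
  have hb : ∀ x, ∀ h : ℝ → ℂ, Integrable h (cmMu w) →
      Integrable (fun t => h t * (cmK n (θ x - θ t) : ℂ)) (cmMu w) := by
    intro x h hh
    refine hh.mul_bdd (c := (n : ℝ) + 1) ?_ (Filter.Eventually.of_forall fun t => ?_)
    · exact (Complex.continuous_ofReal.comp ((cmK_cont n).comp
        (by fun_prop))).aestronglyMeasurable
    · rw [Complex.norm_real, Real.norm_of_nonneg (cmK_nonneg _ _)]
      exact cmK_le _ _
  funext x
  rw [Pi.sub_apply, cm_cesaro_eq θ w hθ hw hw0 _ (hf.sub hg), cm_cesaro_eq θ w hθ hw hw0 _ hf,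
    cm_cesaro_eq θ w hθ hw hw0 _ hg, ← integral_sub (hb x f hf) (hb x g hg)]
  simp [sub_mul]

open scoped ENNReal in
theorem cm_conv (θ w : ℝ → ℝ) (hθ : Continuous θ) (hm : StrictMono θ) (hw : Continuous w)
    (hw0 : ∀ t, 0 < w t) (M : ℝ) (hwM : ∀ t, w t ≤ M)
    (hper : ∀ t : ℝ, θ (t + 2 * π) = θ t + 2 * π) (hd : ∀ t, HasDerivAt θ (w t) t)
    (p : ℝ) (hp : 1 ≤ p) (f : ℝ → ℂ) (hf : Measurable f)
    (hfp : MemLp f (ENNReal.ofReal p) (cmMu w)) :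
    Filter.Tendsto (fun n : ℕ => eLpNorm (f - cesaro θ w f n) (ENNReal.ofReal p) (cmMu w))
      Filter.atTop (nhds 0) := by
  have := cmMu_finite w M hwM
  have hp1 : 1 ≤ ENNReal.ofReal p := by simpa using hp
  rw [ENNReal.tendsto_nhds_zero]
  intro ε hε
  have hε3 : ε / 3 ≠ 0 := (ENNReal.div_pos hε.ne' (by norm_num)).ne'
  obtain ⟨g, hg, hgp⟩ := hfp.exists_boundedContinuous_eLpNorm_sub_le ENNReal.ofReal_ne_top hε3
  have hc := cm_conv_cont θ w hθ hm hw hw0 M hwM hper hd g g.continuous ‖g‖ g.norm_coe_le_norm p hp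
  have hfi := hfp.integrable hp1
  have hgi := hgp.integrable hp1
  filter_upwards [(ENNReal.tendsto_nhds_zero.1 hc) (ε / 3) (pos_iff_ne_zero.2 hε3)] with n hn
  have e : f - cesaro θ w f n = (f - ⇑g) + ((⇑g - cesaro θ w g n) - cesaro θ w (f - ⇑g) n) := by
    rw [cm_cesaro_sub θ w hθ hw hw0 f g hfi hgi]
    abel
  have hm1 : AEStronglyMeasurable (f - ⇑g) (cmMu w) := hfi.1.sub hgi.1
  have hm2 : AEStronglyMeasurable (⇑g - cesaro θ w g n) (cmMu w) :=
    hgi.1.sub (cm_cesaro_cont θ w hθ g n).aestronglyMeasurable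
  have hm3 : AEStronglyMeasurable (cesaro θ w (f - ⇑g) n) (cmMu w) :=
    (cm_cesaro_cont θ w hθ _ n).aestronglyMeasurable
  have h3 := cm_contract θ w hθ hw hw0 M hwM hper hd (f - ⇑g) (hf.sub g.continuous.measurable)
    (hfi.sub hgi) p hp n
  rw [e]
  calc _ ≤ _ := eLpNorm_add_le hm1 (hm2.sub hm3) hp1
    _ ≤ _ := add_le_add_right (eLpNorm_sub_le hm2 hm3 hp1) _
    _ ≤ ε / 3 + (ε / 3 + ε / 3) := add_le_add hg (add_le_add hn (h3.trans hg))
    _ = ε := by rw [← add_assoc]; exact ENNReal.add_thirds ε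

open scoped ENNReal in
theorem cm_pNorm (p : ℝ) (hp : 1 ≤ p) (g : ℝ → ℂ)
    (hg : MemLp g (ENNReal.ofReal p) (volume.restrict (Set.Ioc (-π) π))) :
    pNorm p g = (1 / (2 * π)) ^ (1 / p) *
      (eLpNorm g (ENNReal.ofReal p) (volume.restrict (Set.Ioc (-π) π))).toReal := by
  have hp0 : 0 < p := by linarith
  have hpe : ENNReal.ofReal p ≠ 0 := by simpa using hp0
  have hpt : ENNReal.ofReal p ≠ ∞ := ENNReal.ofReal_ne_top
  have hI : 0 ≤ ∫ t in Set.Ioc (-π) π, ‖g t‖ ^ p := integral_nonneg fun t => by positivity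
  rw [hg.eLpNorm_eq_integral_rpow_norm hpe hpt, ENNReal.toReal_ofReal hp0.le,
    ENNReal.toReal_ofReal (by positivity), pNorm,
    intervalIntegral.integral_of_le (by linarith [pi_pos]), Real.mul_rpow (by positivity) hI,
    one_div p]

open scoped ENNReal in
theorem cm_eLp_le (g : ℝ → ℂ) (p : ℝ) (hp : 1 ≤ p) (μ ν : Measure ℝ) (c : ℝ) (hc : 0 < c)
    (h : μ ≤ ENNReal.ofReal c • ν) :
    eLpNorm g (ENNReal.ofReal p) μ ≤ ENNReal.ofReal (c ^ (1 / p)) * eLpNorm g (ENNReal.ofReal p) ν := by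
  have hp0 : 0 < p := by linarith
  refine (eLpNorm_mono_measure g h).trans (le_of_eq ?_)
  rw [eLpNorm_smul_measure_of_ne_top ENNReal.ofReal_ne_top, smul_eq_mul]
  congr 1
  rw [← ENNReal.ofReal_rpow_of_pos hc]
  congr 1
  simp [hp0.le]

theorem cesaro_means_Lp_bound_and_convergence
    (a : ℂ) (ha : ‖a‖ < 1) (ta : ℝ) (hA : a = (‖a‖ : ℂ) * Complex.exp (Complex.I * (ta : ℂ)))
    (θ : ℝ → ℝ) (hθc : Continuous θ) (hθm : StrictMono θ)
    (hper : ∀ t : ℝ, θ (t + 2 * π) = θ t + 2 * π)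
    (hderiv : ∀ t : ℝ, HasDerivAt θ (poisson a ta t) t)
    (p : ℝ) (hp : 1 ≤ p)
    (f : ℝ → ℂ) (hfm : Measurable f) (hfper : Function.Periodic f (2 * π))
    (hfi : IntervalIntegrable f MeasureTheory.volume (-π) π)
    (hfp : IntervalIntegrable (fun t => ‖f t‖ ^ p) MeasureTheory.volume (-π) π) :
    (∀ n : ℕ, pNorm p (cesaro θ (poisson a ta) f n) ≤
        ((1 + ‖a‖) / (1 - ‖a‖)) ^ (2 / p) * pNorm p f) ∧
      Filter.Tendsto
        (fun n : ℕ => pNorm p (fun x => f x - cesaro θ (poisson a ta) f n x))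
        Filter.atTop (nhds 0) := by
  have hp0 : 0 < p := by linarith
  have hpe : ENNReal.ofReal p ≠ 0 := by simpa using hp0
  have hpt : ENNReal.ofReal p ≠ ⊤ := ENNReal.ofReal_ne_top
  have hp1 : 1 ≤ ENNReal.ofReal p := by simpa using hp
  have hr : 0 < 1 - ‖a‖ := by linarith
  set w := poisson a ta with hwdef
  set M := (1 + ‖a‖) / (1 - ‖a‖) with hMdef
  have hM : 0 < M := by positivity
  have hw : Continuous w := cm_poisson_cont a ha ta
  have hw0 : ∀ t, 0 < w t := cm_poisson_pos a ha ta
  have hwM : ∀ t, w t ≤ M := cm_poisson_le a ha ta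
  have hle := cmMu_le w M hwM
  have hge := cmMu_ge w hw M hM (cm_poisson_ge a ha ta)
  have hfin := cmMu_finite w M hwM
  set lam := volume.restrict (Set.Ioc (-π) π) with hlam
  have hfl : MemLp f (ENNReal.ofReal p) lam := by
    rw [← integrable_norm_rpow_iff hfm.aestronglyMeasurable hpe hpt, ENNReal.toReal_ofReal hp0.le]
    exact (intervalIntegrable_iff_integrableOn_Ioc_of_le (by linarith [pi_pos])).1 hfp
  have hfmu : MemLp f (ENNReal.ofReal p) (cmMu w) :=
    (hfl.smul_measure ENNReal.ofReal_ne_top).mono_measure hle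
  have hfint := hfmu.integrable hp1
  have hc2 : 0 < M / (2 * π) := by positivity
  have hc1 : 0 < M * (2 * π) := by positivity
  have hA := fun g => cm_eLp_le g p hp _ _ _ hc1 hge
  have hB := fun g => cm_eLp_le g p hp _ _ _ hc2 hle
  have hbound : ∀ n, eLpNorm (cesaro θ w f n) (ENNReal.ofReal p) lam
      ≤ ENNReal.ofReal (M ^ (2 / p)) * eLpNorm f (ENNReal.ofReal p) lam := by
    intro n
    refine (hA _).trans ?_
    refine (mul_le_mul_right ((cm_contract θ w hθc hw hw0 M hwM hper hderiv f hfm hfint p hp n).trans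
      (hB f)) _).trans (le_of_eq ?_)
    rw [← mul_assoc, ← ENNReal.ofReal_mul (by positivity), ← Real.mul_rpow hc1.le hc2.le]
    congr 2
    have : M * (2 * π) * (M / (2 * π)) = M ^ (2 : ℝ) := by
      rw [Real.rpow_two]; field_simp
    rw [this, ← Real.rpow_mul hM.le]
    congr 1
    ring
  have hcl : ∀ n, MemLp (cesaro θ w f n) (ENNReal.ofReal p) lam := fun n =>
    ⟨(cm_cesaro_cont θ w hθc f n).aestronglyMeasurable,
      (hbound n).trans_lt (ENNReal.mul_lt_top ENNReal.ofReal_lt_top hfl.2)⟩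
  refine ⟨fun n => ?_, ?_⟩
  · rw [cm_pNorm p hp _ (hcl n), cm_pNorm p hp _ hfl]
    have h := ENNReal.toReal_mono (ENNReal.mul_ne_top ENNReal.ofReal_ne_top hfl.2.ne) (hbound n)
    rw [ENNReal.toReal_mul, ENNReal.toReal_ofReal (by positivity)] at h
    have h' := mul_le_mul_of_nonneg_left h (show 0 ≤ (1 / (2 * π)) ^ (1 / p) by positivity)
    refine h'.trans (le_of_eq ?_)
    ring
  · have hconv := cm_conv θ w hθc hθm hw hw0 M hwM hper hderiv p hp f hfm hfmu
    have h0 : Filter.Tendsto (fun n : ℕ => eLpNorm (f - cesaro θ w f n) (ENNReal.ofReal p) lam)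
        Filter.atTop (nhds 0) := by
      have h1 := ENNReal.Tendsto.const_mul (a := ENNReal.ofReal ((M * (2 * π)) ^ (1 / p))) hconv
        (Or.inr ENNReal.ofReal_ne_top)
      rw [mul_zero] at h1
      exact tendsto_of_tendsto_of_tendsto_of_le_of_le tendsto_const_nhds h1
        (fun _ => zero_le) (fun n => hA _)
    have h2 := ((ENNReal.tendsto_toReal ENNReal.zero_ne_top).comp h0).const_mul
      ((1 / (2 * π)) ^ (1 / p))
    simp only [ENNReal.toReal_zero, mul_zero] at h2
    refine h2.congr fun n => ?_
    exact (cm_pNorm p hp _ (hfl.sub (hcl n))).symm
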